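/- arXiv:2212.14654 — 2 statements merged into one kernel-verified Lean document; each statement's English description precedes it below -/
import Mathlib

section
/- For every integer m and every real x, the Bessel function satisfies |J_m(x)| ≤ (|x|/2)^|m| / (|m|)!. -/
open Real MeasureTheory Nat

/-- Bessel function of the first kind of integer order `m`, defined by Bessel's integral
`J_m(x) = (1/π) ∫_0^π cos(x sin θ − m θ) dθ`. -/
noncomputable def besselJ (m : ℤ) (x : ℝ) : ℝ :=
  (1 / π) * ∫ θ in (0:ℝ)..π, Real.cos (x * Real.sin θ - m * θ)

/-- `x J_m'(x) = x J_{m-1}(x) - m J_m(x)`, with `J_m'` given by differentiating under the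
integral sign. -/
theorem mul_integral_sin_mul_sin (m : ℤ) (x : ℝ) :
    x * ((1 / π) * ∫ θ in (0:ℝ)..π, -Real.sin (x * Real.sin θ - m * θ) * Real.sin θ) =
      x * besselJ (m - 1) x - m * besselJ m x := by
  have key : ∫ θ in (0:ℝ)..π, Real.cos (x * Real.sin θ - m * θ) * (x * Real.cos θ - m) = 0 := by
    rw [intervalIntegral.integral_eq_sub_of_hasDerivAt
      (f := fun θ => Real.sin (x * Real.sin θ - m * θ))]
    · simp [Real.sin_int_mul_pi]
    · intro θ _
      simpa using (((Real.hasDerivAt_sin θ).const_mul x).sub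
        ((hasDerivAt_id θ).const_mul (m : ℝ))).sin
    · exact Continuous.intervalIntegrable (by fun_prop) _ _
  have split : ∫ θ in (0:ℝ)..π, Real.cos (x * Real.sin θ - m * θ) * (x * Real.cos θ - m) =
      x * (∫ θ in (0:ℝ)..π, Real.cos (x * Real.sin θ - (m - 1 : ℤ) * θ)) -
      m * (∫ θ in (0:ℝ)..π, Real.cos (x * Real.sin θ - m * θ)) -
      x * ∫ θ in (0:ℝ)..π, -Real.sin (x * Real.sin θ - m * θ) * Real.sin θ := by
    simp only [← intervalIntegral.integral_const_mul]
    rw [← intervalIntegral.integral_sub, ← intervalIntegral.integral_sub]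
    · refine intervalIntegral.integral_congr fun θ _ => ?_
      have h : x * Real.sin θ - (m - 1 : ℤ) * θ = (x * Real.sin θ - m * θ) + θ := by
        push_cast; ring
      simp only [h, Real.cos_add]
      ring
    all_goals exact Continuous.intervalIntegrable (by fun_prop) _ _
  rw [key] at split
  unfold besselJ
  linear_combination (1 / π) * split

theorem hasDerivAt_besselJ (m : ℤ) (x : ℝ) :
    HasDerivAt (besselJ m)
      ((1 / π) * ∫ θ in (0:ℝ)..π, -Real.sin (x * Real.sin θ - m * θ) * Real.sin θ) x := by
  refine HasDerivAt.const_mul (1 / π) ?_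
  refine (intervalIntegral.hasDerivAt_integral_of_dominated_loc_of_deriv_le
    (F := fun x θ => Real.cos (x * Real.sin θ - m * θ))
    (F' := fun x θ => -Real.sin (x * Real.sin θ - m * θ) * Real.sin θ)
    (bound := fun _ => 1) Filter.univ_mem ?_ ?_ ?_ ?_ ?_ ?_).2
  · exact Filter.Eventually.of_forall fun y =>
      Continuous.aestronglyMeasurable (by fun_prop)
  · exact Continuous.intervalIntegrable (by fun_prop) _ _
  · exact Continuous.aestronglyMeasurable (by fun_prop)
  · refine Filter.Eventually.of_forall fun θ _ y _ => ?_
    rw [norm_mul, norm_neg]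
    exact mul_le_one₀ (Real.abs_sin_le_one _) (norm_nonneg _) (Real.abs_sin_le_one _)
  · exact intervalIntegrable_const
  · refine Filter.Eventually.of_forall fun θ _ y _ => ?_
    simpa using (((hasDerivAt_id y).mul_const (Real.sin θ)).sub_const (m * θ)).cos

theorem hasDerivAt_pow_mul_besselJ (n : ℕ) (x : ℝ) :
    HasDerivAt (fun t => t ^ (n + 1) * besselJ (n + 1 : ℕ) t) (x ^ (n + 1) * besselJ n x) x := by
  have h := (hasDerivAt_pow (n + 1) x).mul (hasDerivAt_besselJ (n + 1 : ℕ) x)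
  have hrec := mul_integral_sin_mul_sin (n + 1 : ℕ) x
  rw [show ((n + 1 : ℕ) : ℤ) - 1 = n by push_cast; ring] at hrec
  refine h.congr_deriv ?_
  rw [Nat.add_sub_cancel, pow_succ, mul_assoc _ x, hrec]
  push_cast
  ring

theorem besselJ_neg_order (m : ℤ) (x : ℝ) : besselJ (-m) x = besselJ m (-x) := by
  unfold besselJ
  congr 2 with θ
  rw [← Real.cos_neg]
  congr 1
  push_cast
  ring

theorem abs_besselJ_neg (m : ℤ) (x : ℝ) : |besselJ m (-x)| = |besselJ m x| := by
  have h : ∀ θ : ℝ, Real.cos (-x * Real.sin (π - θ) - m * (π - θ)) =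
      (-1) ^ m * Real.cos (x * Real.sin θ - m * θ) := fun θ => by
    rw [Real.sin_pi_sub, ← Real.cos_add_int_mul_pi, ← Real.cos_neg]
    congr 1
    ring
  have hint := intervalIntegral.integral_comp_sub_left (a := 0) (b := π)
    (fun θ => Real.cos (-x * Real.sin θ - m * θ)) π
  simp only [h, sub_self, sub_zero, intervalIntegral.integral_const_mul] at hint
  unfold besselJ
  rw [← hint, abs_mul, abs_mul, abs_mul, abs_zpow]
  simp

theorem abs_besselJ_le_one (m : ℤ) (x : ℝ) : |besselJ m x| ≤ 1 := by
  have h := intervalIntegral.norm_integral_le_of_norm_le_const (a := 0) (b := π) (C := 1)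
    (f := fun θ => Real.cos (x * Real.sin θ - m * θ)) fun θ _ => Real.abs_cos_le_one _
  rw [sub_zero, abs_of_pos pi_pos, one_mul, Real.norm_eq_abs] at h
  rw [besselJ, abs_mul, abs_of_pos (one_div_pos.2 pi_pos), one_div_mul_eq_div]
  exact (div_le_one pi_pos).2 h

theorem abs_besselJ_natCast_le (n : ℕ) {x : ℝ} (hx : 0 ≤ x) :
    |besselJ n x| ≤ (x / 2) ^ n / n ! := by
  induction n generalizing x with
  | zero => simpa using abs_besselJ_le_one 0 x
  | succ n ih =>
    have hB : ∀ t : ℝ, HasDerivAt (fun t : ℝ => t ^ (2 * n + 2) / (2 ^ (n + 1) * (n + 1)!))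
        (t ^ (n + 1) * ((t / 2) ^ n / n !)) t := fun t => by
      refine ((hasDerivAt_pow (2 * n + 2) t).div_const _).congr_deriv ?_
      rw [Nat.factorial_succ, show 2 * n + 2 - 1 = n + 1 + n by lia, pow_add, div_pow]
      push_cast
      field_simp
      ring
    have hbound : ‖x ^ (n + 1) * besselJ (n + 1 : ℕ) x‖ ≤
        x ^ (2 * n + 2) / (2 ^ (n + 1) * (n + 1)!) :=
      image_norm_le_of_norm_deriv_right_le_deriv_boundary (a := 0) (b := x)
        (fun t _ => (hasDerivAt_pow_mul_besselJ n t).continuousAt.continuousWithinAt)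
        (fun t _ => (hasDerivAt_pow_mul_besselJ n t).hasDerivWithinAt)
        (by simp) hB
        (fun t ht => by
          rw [norm_mul, norm_pow, Real.norm_of_nonneg ht.1, Real.norm_eq_abs]
          exact mul_le_mul_of_nonneg_left (ih ht.1) (pow_nonneg ht.1 _))
        ⟨hx, le_rfl⟩
    rcases hx.eq_or_lt with rfl | hpos
    · have h0 := mul_integral_sin_mul_sin (n + 1 : ℕ) 0
      have hne : ((n + 1 : ℕ) : ℝ) ≠ 0 := by positivity
      have : besselJ (n + 1 : ℕ) 0 = 0 := by
        simp only [zero_mul, zero_sub] at h0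
        rw [Int.cast_natCast] at h0
        simpa [hne] using mul_eq_zero.1 (neg_eq_zero.1 h0.symm) |>.resolve_left hne
      rw [this, abs_zero]
      positivity
    · rw [norm_mul, norm_pow, Real.norm_of_nonneg hx, Real.norm_eq_abs] at hbound
      refine le_of_mul_le_mul_left (hbound.trans_eq ?_) (pow_pos hpos (n + 1))
      rw [div_pow]
      field_simp
      ring

/-- For every integer `m` and real `x`, `|J_m(x)| ≤ (|x|/2)^{|m|} / (|m|)!`. -/
theorem besselJ_le_factorial (m : ℤ) (x : ℝ) :
    |besselJ m x| ≤ (|x| / 2) ^ m.natAbs / (m.natAbs)! := by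
  have habs : |besselJ m x| = |besselJ m.natAbs (|x|)| := by
    have hx : |besselJ m.natAbs (|x|)| = |besselJ m.natAbs x| := by
      rcases abs_choice x with h | h <;> rw [h]
      exact abs_besselJ_neg _ _
    rw [hx]
    rcases Int.natAbs_eq m with h | h
    · rw [← h]
    · conv_lhs => rw [h]
      rw [besselJ_neg_order, abs_besselJ_neg]
  rw [habs]
  exact abs_besselJ_natCast_le _ (abs_nonneg x)
end

section
/- For every natural number N ≥ 1 and all reals β, c, the family (fun t : ℤ => J_{N*t}(β) * Complex.exp (Complex.I * N * t * c)) indexed by t ∈ ℤ has sum (1/N) * Σ_{n=1}^{N} Complex.exp (Complex.I * β * Real.sin (2 * π * n / N + c)); that is, the exact aliasing identity (1/N) Σ_{n=1}^N e^{iβ sin(2πn/N + c)} = Σ_{t∈ℤ} J_{Nt}(β) e^{iNtc} holds. -/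
open Real MeasureTheory

/-- The Fourier coefficients of a `C¹` function on `[a, b]` with equal endpoint values are
absolutely summable. -/
lemma summable_fourierCoeffOn_of_hasDerivAt {a b : ℝ} (hab : a < b) {f f' : ℝ → ℂ}
    (hf : ∀ x, HasDerivAt f (f' x) x) (hf' : Continuous f') (hper : f b = f a) :
    Summable (fourierCoeffOn hab f) := by
  have hL2 : MemLp f' 2 (volume.restrict (Set.Ioc a b)) := by
    rw [memLp_two_iff_integrable_sq_norm hf'.aestronglyMeasurable]
    exact ((by fun_prop : Continuous fun x => ‖f' x‖ ^ 2).integrableOn_Icc).mono_set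
      Set.Ioc_subset_Icc_self
  have hsq := (hasSum_sq_fourierCoeffOn hab hL2).summable
  have hinv : Summable fun n : ℤ => 1 / (n : ℝ) ^ 2 :=
    Real.summable_one_div_int_pow.mpr one_lt_two
  refine Summable.of_norm_bounded_eventually ((hsq.add hinv).mul_left (b - a)) ?_
  rw [Filter.eventually_cofinite]
  refine (Set.finite_singleton (0 : ℤ)).subset fun n hn => ?_
  by_contra hn0
  refine hn ?_
  have hn0 : n ≠ 0 := hn0
  have hnpos : 0 < |(n : ℝ)| := abs_pos.mpr (Int.cast_ne_zero.mpr hn0)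
  rw [fourierCoeffOn_of_hasDerivAt hab hn0 (fun x _ => hf x) (hf'.intervalIntegrable _ _), hper,
    sub_self, mul_zero, zero_sub, ← Complex.ofReal_sub]
  simp only [norm_mul, norm_neg, norm_div, norm_one, Complex.norm_real, Complex.norm_I,
    Complex.norm_intCast, Complex.norm_ofNat, Real.norm_eq_abs, abs_of_pos pi_pos,
    abs_of_pos (sub_pos.mpr hab), mul_one]
  set u := ‖fourierCoeffOn hab f' n‖
  have hinv_sq : 1 / (n : ℝ) ^ 2 = (1 / |(n : ℝ)|) ^ 2 := by rw [div_pow, sq_abs, one_pow]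
  have hle : 1 / (2 * π * |(n : ℝ)|) ≤ 1 / |(n : ℝ)| :=
    one_div_le_one_div_of_le hnpos (by nlinarith [pi_gt_three])
  rw [hinv_sq]
  set v := 1 / |(n : ℝ)|
  have hu : 0 ≤ u := norm_nonneg _
  have hv : 0 ≤ v := by positivity
  calc 1 / (2 * π * |(n : ℝ)|) * ((b - a) * u) ≤ v * ((b - a) * u) := by
        gcongr
    _ = (b - a) * (u * v) := by ring
    _ ≤ (b - a) * (u ^ 2 + v ^ 2) := by
        have := sub_pos.mpr hab
        gcongr
        nlinarith [sq_nonneg (u - v), mul_nonneg hu hv]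

/-- A `C¹` periodic function is the pointwise sum of its Fourier series. -/
lemma Function.Periodic.hasSum_fourier_series {T : ℝ} [hT : Fact (0 < T)] {f f' : ℝ → ℂ}
    (hper : Function.Periodic f T) (hf : ∀ x, HasDerivAt f (f' x) x) (hf' : Continuous f')
    (a x : ℝ) :
    HasSum (fun n : ℤ => ((1 / T) • ∫ y in a..a + T, fourier (-n) (y : AddCircle T) • f y) •
      fourier n (x : AddCircle T)) (f x) := by
  have hcont : Continuous f := continuous_iff_continuousAt.mpr fun x => (hf x).continuousAt
  let F : C(AddCircle T, ℂ) := ⟨hper.lift, hcont.quotient_lift _⟩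
  have hcoeff (n : ℤ) : fourierCoeff F n =
      (1 / T) • ∫ y in a..a + T, fourier (-n) (y : AddCircle T) • f y :=
    fourierCoeff_eq_intervalIntegral F n a
  have hsum : Summable (fourierCoeff F) := by
    convert! summable_fourierCoeffOn_of_hasDerivAt (lt_add_of_pos_right a hT.out) hf hf' (hper a)
      using 1
    ext n
    rw [hcoeff, fourierCoeffOn_eq_integral]
    simp only [fourier_coe_apply, add_sub_cancel_left]
  have h := has_pointwise_sum_fourier_series_of_summable hsum (x : AddCircle T)
  simp only [hcoeff] at h
  exact h

lemma integral_exp_sin_eq_besselJ (m : ℤ) (x : ℝ) :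
    ∫ θ in -π..π, Complex.exp (-(Complex.I * m * θ)) * Complex.exp (Complex.I * x * Real.sin θ) =
      2 * π * (besselJ m x : ℂ) := by
  have hint (a b : ℝ) : IntervalIntegrable (fun θ : ℝ =>
      Complex.exp (-(Complex.I * m * θ)) * Complex.exp (Complex.I * x * Real.sin θ)) volume a b :=
    Continuous.intervalIntegrable (by fun_prop) _ _
  have hneg := intervalIntegral.integral_comp_neg (a := 0) (b := π) fun θ : ℝ =>
    Complex.exp (-(Complex.I * m * θ)) * Complex.exp (Complex.I * x * Real.sin θ)
  rw [neg_zero] at hneg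
  rw [← intervalIntegral.integral_add_adjacent_intervals (hint (-π) 0) (hint 0 π), ← hneg,
    ← intervalIntegral.integral_add (Continuous.intervalIntegrable (by fun_prop) _ _) (hint 0 π)]
  have hcos (θ : ℝ) :
      Complex.exp (-(Complex.I * m * (-θ : ℝ))) * Complex.exp (Complex.I * x * Real.sin (-θ)) +
        Complex.exp (-(Complex.I * m * θ)) * Complex.exp (Complex.I * x * Real.sin θ) =
      2 * (Real.cos (x * Real.sin θ - m * θ) : ℂ) := by
    rw [← Complex.exp_add, ← Complex.exp_add, Complex.ofReal_cos, Complex.two_cos, add_comm]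
    congr 2 <;> push_cast [Real.sin_neg] <;> ring
  simp_rw [hcos]
  rw [intervalIntegral.integral_const_mul, intervalIntegral.integral_ofReal, besselJ]
  have : (π : ℂ) ≠ 0 := Complex.ofReal_ne_zero.mpr pi_ne_zero
  push_cast
  field_simp

/-- The **Jacobi–Anger expansion**. -/
lemma hasSum_besselJ_mul_exp (β θ : ℝ) :
    HasSum (fun m : ℤ => (besselJ m β : ℂ) * Complex.exp (Complex.I * m * θ))
      (Complex.exp (Complex.I * β * Real.sin θ)) := by
  have hT : Fact (0 < 2 * π) := ⟨two_pi_pos⟩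
  have hper : Function.Periodic (fun θ : ℝ => Complex.exp (Complex.I * β * Real.sin θ)) (2 * π) :=
    fun θ => by simp only [Real.sin_add_two_pi]
  have hderiv (θ : ℝ) : HasDerivAt (fun θ : ℝ => Complex.exp (Complex.I * β * Real.sin θ))
      (Complex.exp (Complex.I * β * Real.sin θ) * (Complex.I * β * Real.cos θ)) θ :=
    ((Real.hasDerivAt_sin θ).ofReal_comp.const_mul (Complex.I * β)).cexp
  convert! hper.hasSum_fourier_series hderiv (by fun_prop) (-π) θ using 2 with m
  have hπ : (π : ℂ) ≠ 0 := Complex.ofReal_ne_zero.mpr pi_ne_zero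
  have hexp (k : ℤ) (y : ℝ) :
      fourier k (y : AddCircle (2 * π)) = Complex.exp (Complex.I * k * y) := by
    rw [fourier_coe_apply]
    congr 1
    push_cast
    field_simp
  have h := integral_exp_sin_eq_besselJ m β
  simp only [hexp, smul_eq_mul, Complex.real_smul, Int.cast_neg, mul_neg, neg_mul,
    show -π + 2 * π = π by ring]
  rw [h]
  push_cast
  field_simp

/-- Orthogonality of the characters of `ℤ / N`. -/
lemma sum_Icc_exp_two_pi_mul_div (N : ℕ) (hN : N ≠ 0) (m : ℤ) :
    ∑ n ∈ Finset.Icc 1 N, Complex.exp (2 * π * Complex.I * (m / N)) ^ n =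
      if (N : ℤ) ∣ m then (N : ℂ) else 0 := by
  have hN' : (N : ℂ) ≠ 0 := Nat.cast_ne_zero.mpr hN
  have hone : Complex.exp (2 * π * Complex.I * (m / N)) = 1 ↔ (N : ℤ) ∣ m := by
    rw [Complex.exp_eq_one_iff]
    refine exists_congr fun k => ?_
    rw [mul_comm (k : ℂ), mul_right_inj' Complex.two_pi_I_ne_zero, div_eq_iff hN', mul_comm]
    exact_mod_cast Iff.rfl
  split_ifs with h
  · simp [hone.mpr h]
  · have hpow : Complex.exp (2 * π * Complex.I * (m / N)) ^ N = 1 := by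
      rw [← Complex.exp_nat_mul, Complex.exp_eq_one_iff]
      exact ⟨m, by field_simp⟩
    rw [← Finset.Ico_add_one_right_eq_Icc, Finset.sum_Ico_eq_sum_range]
    simp only [Nat.add_sub_cancel, pow_add, ← Finset.mul_sum]
    rw [geom_sum_eq (hone.not.mpr h), hpow, sub_self, zero_div, mul_zero]

/-- Exact aliasing identity:
`(1/N) Σ_{n=1}^N e^{iβ sin(2πn/N + c)} = Σ_{t ∈ ℤ} J_{Nt}(β) e^{iNtc}`,
with the right-hand side series summable. -/
theorem aliasing_identity (N : ℕ) (hN : 1 ≤ N) (β c : ℝ) :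
    HasSum (fun t : ℤ =>
        (besselJ ((N : ℤ) * t) β : ℂ) * Complex.exp (Complex.I * N * t * c))
      ((1 / N : ℂ) *
        ∑ n ∈ Finset.Icc 1 N,
          Complex.exp (Complex.I * β * Real.sin (2 * π * n / N + c))) := by
  have hN0 : N ≠ 0 := Nat.one_le_iff_ne_zero.mp hN
  have hN' : (N : ℂ) ≠ 0 := Nat.cast_ne_zero.mpr hN0
  have hinj : Function.Injective fun t : ℤ => (N : ℤ) * t :=
    mul_right_injective₀ (Nat.cast_ne_zero.mpr hN0)
  have hsum := (hasSum_sum fun n (_ : n ∈ Finset.Icc 1 N) =>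
    hasSum_besselJ_mul_exp β (2 * π * n / N + c)).mul_left (1 / N : ℂ)
  have hterm (m : ℤ) : (1 / N : ℂ) * ∑ n ∈ Finset.Icc 1 N, (besselJ m β : ℂ) *
        Complex.exp (Complex.I * m * (2 * π * n / N + c : ℝ)) =
      if (N : ℤ) ∣ m then (besselJ m β : ℂ) * Complex.exp (Complex.I * m * c) else 0 := by
    have hsplit (n : ℕ) : (besselJ m β : ℂ) *
          Complex.exp (Complex.I * m * (2 * π * n / N + c : ℝ)) =
        (besselJ m β : ℂ) * Complex.exp (Complex.I * m * c) *
          Complex.exp (2 * π * Complex.I * (m / N)) ^ n := by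
      rw [← Complex.exp_nat_mul, mul_assoc (besselJ m β : ℂ), ← Complex.exp_add]
      congr 2
      push_cast
      ring
    simp only [hsplit]
    rw [← Finset.mul_sum, sum_Icc_exp_two_pi_mul_div N hN0]
    split_ifs
    · field_simp
    · simp
  simp only [hterm] at hsum
  rw [← hinj.hasSum_iff fun m hm => if_neg fun ⟨k, hk⟩ => hm ⟨k, hk.symm⟩] at hsum
  convert! hsum using 2 with t
  simp [mul_assoc]
end
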